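/- Let G = F_2^n, fix finitely supported G-valued random variables X_1^0, X_2^0, X_1, X_2, and set η = 1/9. Let (T_1, T_2, T_3) be a G^3-valued finitely supported random variable such that T_1 + T_2 + T_3 = 0 holds identically, and set δ := I[T_1 : T_2] + I[T_1 : T_3] + I[T_2 : T_3]. Then there exist finitely supported G-valued random variables T_1', T_2' such that d[T_1'; T_2'] + η(d[X_1^0; T_1'] − d[X_1^0; X_1]) + η(d[X_2^0; T_2'] − d[X_2^0; X_2]) ≤ δ + (η/3)·(δ + Σ_{i=1}^{2} Σ_{j=1}^{3} (d[X_i^0; T_j] − d[X_i^0; X_i])). -/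

import Mathlib

open scoped Classical BigOperators Pointwise
open Finset

noncomputable section

/-- The probability that the random variable `X` equals `s`, under the pmf `μ`. -/
def pmass {Ω S : Type*} [Fintype Ω] (μ : Ω → ℝ) (X : Ω → S) (s : S) : ℝ :=
  ∑ ω, if X ω = s then μ ω else 0

/-- `μ` is a probability mass function on the finite type `Ω`. -/
def IsProb {Ω : Type*} [Fintype Ω] (μ : Ω → ℝ) : Prop :=
  (∀ ω, 0 ≤ μ ω) ∧ ∑ ω, μ ω = 1

/-- Shannon entropy `H[X]` of a random variable `X : Ω → S` under `μ`. -/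
def ent {Ω S : Type*} [Fintype Ω] (μ : Ω → ℝ) (X : Ω → S) : ℝ :=
  ∑ s ∈ Finset.univ.image X, Real.negMulLog (pmass μ X s)

/-- Mutual information `I[X : Y]`. -/
def mutualInfo {Ω S T : Type*} [Fintype Ω] (μ : Ω → ℝ) (X : Ω → S) (Y : Ω → T) : ℝ :=
  ent μ X + ent μ Y - ent μ (fun ω => (X ω, Y ω))

/-- The conditional measure, conditioning on the event `Y = y`. -/
def condMeas {Ω T : Type*} [Fintype Ω] (μ : Ω → ℝ) (Y : Ω → T) (y : T) : Ω → ℝ :=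
  fun ω => if Y ω = y then μ ω / pmass μ Y y else 0

/-- Conditional mutual information `I[X : Y | Z]`. -/
def condMutualInfo {Ω S T U : Type*} [Fintype Ω] (μ : Ω → ℝ)
    (X : Ω → S) (Y : Ω → T) (Z : Ω → U) : ℝ :=
  ∑ z ∈ Finset.univ.image Z, pmass μ Z z * mutualInfo (condMeas μ Z z) X Y

/-- Entropic Ruzsa distance `d[X ; Y]`, defined via independent copies on a product space. -/
def rdist {Ω₁ Ω₂ G : Type*} [Fintype Ω₁] [Fintype Ω₂] [AddCommGroup G]
    (μ₁ : Ω₁ → ℝ) (X : Ω₁ → G) (μ₂ : Ω₂ → ℝ) (Y : Ω₂ → G) : ℝ :=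
  ent (fun p : Ω₁ × Ω₂ => μ₁ p.1 * μ₂ p.2) (fun p => X p.1 - Y p.2)
    - ent μ₁ X / 2 - ent μ₂ Y / 2

/-- Conditional Ruzsa distance `d[X | Z ; Y | W]`. -/
def condRdist {Ω₁ Ω₂ G T U : Type*} [Fintype Ω₁] [Fintype Ω₂] [AddCommGroup G]
    (μ₁ : Ω₁ → ℝ) (X : Ω₁ → G) (Z : Ω₁ → T)
    (μ₂ : Ω₂ → ℝ) (Y : Ω₂ → G) (W : Ω₂ → U) : ℝ :=
  ∑ z ∈ Finset.univ.image Z, ∑ w ∈ Finset.univ.image W,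
    pmass μ₁ Z z * pmass μ₂ W w * rdist (condMeas μ₁ Z z) X (condMeas μ₂ W w) Y

/-- Conditional Ruzsa distance `d[X ; Y | W]`, conditioning only on the right variable. -/
def condRdistRight {Ω₁ Ω₂ G U : Type*} [Fintype Ω₁] [Fintype Ω₂] [AddCommGroup G]
    (μ₁ : Ω₁ → ℝ) (X : Ω₁ → G)
    (μ₂ : Ω₂ → ℝ) (Y : Ω₂ → G) (W : Ω₂ → U) : ℝ :=
  ∑ w ∈ Finset.univ.image W, pmass μ₂ W w * rdist μ₁ X (condMeas μ₂ W w) Y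

/-- The uniform probability mass function on a subset `H` of a finite type. -/
def unifOn {G : Type*} [Fintype G] (H : Set G) : G → ℝ :=
  fun g => if g ∈ H then ((Nat.card H : ℝ))⁻¹ else 0

/-- `X` (under `μ₁`) and `Y` (under `μ₂`) are identically distributed. -/
def IdentDist {Ω₁ Ω₂ S : Type*} [Fintype Ω₁] [Fintype Ω₂]
    (μ₁ : Ω₁ → ℝ) (X : Ω₁ → S) (μ₂ : Ω₂ → ℝ) (Y : Ω₂ → S) : Prop :=
  ∀ s, pmass μ₁ X s = pmass μ₂ Y s

/-- Two random variables are independent. -/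
def IndepPair {Ω S T : Type*} [Fintype Ω] (μ : Ω → ℝ) (X : Ω → S) (Y : Ω → T) : Prop :=
  ∀ s t, pmass μ (fun ω => (X ω, Y ω)) (s, t) = pmass μ X s * pmass μ Y t

/-- Three random variables are jointly independent. -/
def IndepTriple {Ω S T U : Type*} [Fintype Ω] (μ : Ω → ℝ)
    (X : Ω → S) (Y : Ω → T) (Z : Ω → U) : Prop :=
  ∀ s t u, pmass μ (fun ω => (X ω, Y ω, Z ω)) (s, t, u)
    = pmass μ X s * pmass μ Y t * pmass μ Z u

/-- Four random variables are jointly independent. -/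
def IndepFour {Ω S T U V : Type*} [Fintype Ω] (μ : Ω → ℝ)
    (X : Ω → S) (Y : Ω → T) (Z : Ω → U) (W : Ω → V) : Prop :=
  ∀ s t u v, pmass μ (fun ω => (X ω, Y ω, Z ω, W ω)) (s, t, u, v)
    = pmass μ X s * pmass μ Y t * pmass μ Z u * pmass μ W v


theorem pmass_nonneg' {Ω S : Type*} [Fintype Ω] {μ : Ω → ℝ} (h : ∀ ω, 0 ≤ μ ω) (X : Ω → S) (s : S) :
    0 ≤ pmass μ X s := by
  unfold pmass
  exact Finset.sum_nonneg fun ω _ => by split_ifs <;> simp [h]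

theorem le_pmass {Ω S : Type*} [Fintype Ω] {μ : Ω → ℝ} (h : ∀ ω, 0 ≤ μ ω) (X : Ω → S) (ω : Ω) :
    μ ω ≤ pmass μ X (X ω) := by
  unfold pmass
  have := Finset.single_le_sum (f := fun ω' => if X ω' = X ω then μ ω' else 0)
    (fun i _ => by split_ifs <;> simp [h]) (Finset.mem_univ ω)
  simpa using this

theorem ent_eq {Ω S : Type*} [Fintype Ω] (μ : Ω → ℝ) (X : Ω → S) :
    ent μ X = - ∑ ω, μ ω * Real.log (pmass μ X (X ω)) := by
  unfold ent Real.negMulLog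
  have : ∀ s, -pmass μ X s * Real.log (pmass μ X s)
      = - ∑ ω, if X ω = s then μ ω * Real.log (pmass μ X (X ω)) else 0 := by
    intro s
    rw [neg_mul]
    congr 1
    conv_lhs => rw [pmass, Finset.sum_mul]
    refine Finset.sum_congr rfl fun ω _ => ?_
    split_ifs with h
    · rw [h]; rfl
    · simp
  simp_rw [this]
  rw [Finset.sum_neg_distrib, Finset.sum_comm]
  congr 1
  refine Finset.sum_congr rfl fun ω _ => ?_
  rw [Finset.sum_ite_eq]
  simp

theorem ent_congr {Ω S T : Type*} [Fintype Ω] (μ : Ω → ℝ) (X : Ω → S) (Y : Ω → T)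
    (h : ∀ ω ω', μ ω ≠ 0 → μ ω' ≠ 0 → (X ω = X ω' ↔ Y ω = Y ω')) : ent μ X = ent μ Y := by
  rw [ent_eq, ent_eq]
  congr 1
  refine Finset.sum_congr rfl fun ω _ => ?_
  by_cases h1 : μ ω = 0
  · simp [h1]
  congr 2
  unfold pmass
  refine Finset.sum_congr rfl fun ω' _ => ?_
  by_cases h2 : μ ω' = 0
  · simp [h2]
  simp only [h ω' ω h2 h1]

/-- Summing a function of a random variable. -/
theorem sum_comp_eq {Ω S : Type*} [Fintype Ω] [Fintype S] (μ : Ω → ℝ) (X : Ω → S) (f : S → ℝ) :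
    ∑ ω, μ ω * f (X ω) = ∑ s, pmass μ X s * f s := by
  unfold pmass
  simp_rw [Finset.sum_mul]
  rw [Finset.sum_comm]
  refine Finset.sum_congr rfl fun ω _ => ?_
  simp

theorem sum_pmass_pair {Ω S T : Type*} [Fintype Ω] [Fintype S] (μ : Ω → ℝ) (X : Ω → S) (Y : Ω → T)
    (t : T) : ∑ s, pmass μ (fun ω => (X ω, Y ω)) (s, t) = pmass μ Y t := by
  unfold pmass
  rw [Finset.sum_comm]
  refine Finset.sum_congr rfl fun ω _ => ?_
  by_cases h : Y ω = t <;> simp [h]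

theorem sum_pmass {Ω S : Type*} [Fintype Ω] [Fintype S] (μ : Ω → ℝ) (X : Ω → S) :
    ∑ s, pmass μ X s = ∑ ω, μ ω := by
  simpa using (sum_comp_eq μ X (fun _ => 1)).symm

theorem ent_submod {Ω S T U : Type*} [Fintype Ω] [Fintype S] [Fintype T] [Fintype U]
    {μ : Ω → ℝ} (hμ : IsProb μ) (X : Ω → S) (Y : Ω → T) (W : Ω → U) :
    ent μ (fun ω => (X ω, Y ω, W ω)) + ent μ W
      ≤ ent μ (fun ω => (X ω, W ω)) + ent μ (fun ω => (Y ω, W ω)) := by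
  obtain ⟨h0, h1⟩ := hμ
  simp_rw [ent_eq]
  set a := pmass μ (fun ω => (X ω, Y ω, W ω)) with ha
  set b := pmass μ W with hb
  set c := pmass μ (fun ω => (X ω, W ω)) with hc
  set d := pmass μ (fun ω => (Y ω, W ω)) with hd
  have a0 : ∀ s, 0 ≤ a s := pmass_nonneg' h0 _
  have b0 : ∀ s, 0 ≤ b s := pmass_nonneg' h0 _
  have c0 : ∀ s, 0 ≤ c s := pmass_nonneg' h0 _
  have d0 : ∀ s, 0 ≤ d s := pmass_nonneg' h0 _
  have key : ∀ ω, μ ω * Real.log (c (X ω, W ω)) + μ ω * Real.log (d (Y ω, W ω))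
      - μ ω * Real.log (a (X ω, Y ω, W ω)) - μ ω * Real.log (b (W ω))
      ≤ μ ω * (c (X ω, W ω) * d (Y ω, W ω) / (a (X ω, Y ω, W ω) * b (W ω))) - μ ω := by
    intro ω
    rcases (h0 ω).eq_or_lt with h | h
    · simp [← h]
    · have pa : 0 < a (X ω, Y ω, W ω) := h.trans_le (le_pmass h0 (fun ω => (X ω, Y ω, W ω)) ω)
      have pb : 0 < b (W ω) := h.trans_le (le_pmass h0 _ ω)
      have pc : 0 < c (X ω, W ω) := h.trans_le (le_pmass h0 (fun ω => (X ω, W ω)) ω)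
      have pd : 0 < d (Y ω, W ω) := h.trans_le (le_pmass h0 (fun ω => (Y ω, W ω)) ω)
      have := Real.log_le_sub_one_of_pos (div_pos (mul_pos pc pd) (mul_pos pa pb))
      rw [Real.log_div (by positivity) (by positivity), Real.log_mul pc.ne' pd.ne',
        Real.log_mul pa.ne' pb.ne'] at this
      nlinarith
  have tot : ∑ ω, μ ω * (c (X ω, W ω) * d (Y ω, W ω) / (a (X ω, Y ω, W ω) * b (W ω))) ≤ 1 := by
    rw [sum_comp_eq μ (fun ω => (X ω, Y ω, W ω))
      (fun s => c (s.1, s.2.2) * d (s.2.1, s.2.2) / (a s * b s.2.2))]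
    calc _ ≤ ∑ s : S × T × U, c (s.1, s.2.2) * d (s.2.1, s.2.2) / b s.2.2 := by
          refine Finset.sum_le_sum fun s _ => ?_
          change a s * _ ≤ _
          rcases (a0 s).eq_or_lt with h | h
          · rw [← h]; simp only [zero_mul]
            exact div_nonneg (mul_nonneg (c0 _) (d0 _)) (b0 _)
          · apply le_of_eq
            rw [mul_comm (a s) (b _), ← div_div, mul_div_cancel₀ _ h.ne']
      _ = ∑ u, b u := by
          rw [Fintype.sum_prod_type]
          simp_rw [Fintype.sum_prod_type]
          simp_rw [Finset.sum_comm (s := (Finset.univ : Finset T))]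
          rw [Finset.sum_comm]
          refine Finset.sum_congr rfl fun u _ => ?_
          simp_rw [← Finset.sum_div, ← Finset.mul_sum]
          rw [← Finset.sum_mul, hc, hd, sum_pmass_pair, sum_pmass_pair, ← hb]
          exact mul_self_div_self _
      _ = 1 := by rw [hb, sum_pmass, h1]
  have := Finset.sum_le_sum fun ω (_ : ω ∈ Finset.univ) => key ω
  simp only [Finset.sum_add_distrib, Finset.sum_sub_distrib, h1] at this
  linarith

theorem ent_const {Ω : Type*} [Fintype Ω] {μ : Ω → ℝ} (hμ : IsProb μ) :
    ent μ (fun _ => ()) = 0 := by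
  rw [ent_eq]
  simp [pmass, hμ.2]

theorem ent_subadd {Ω S T : Type*} [Fintype Ω] [Fintype S] [Fintype T]
    {μ : Ω → ℝ} (hμ : IsProb μ) (X : Ω → S) (Y : Ω → T) :
    ent μ (fun ω => (X ω, Y ω)) ≤ ent μ X + ent μ Y := by
  have := ent_submod hμ X Y (fun _ => ())
  rw [ent_const hμ, ent_congr μ (fun ω => (X ω, Y ω, ())) (fun ω => (X ω, Y ω)) (by simp),
    ent_congr μ (fun ω => (X ω, ())) X (by simp), ent_congr μ (fun ω => (Y ω, ())) Y (by simp)] at this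
  linarith

theorem pmass_condMeas {Ω S T : Type*} [Fintype Ω] (μ : Ω → ℝ) (X : Ω → S) (Z : Ω → T) (s : S) (z : T) :
    pmass (condMeas μ Z z) X s = pmass μ (fun ω => (X ω, Z ω)) (s, z) / pmass μ Z z := by
  conv_lhs => unfold pmass condMeas
  conv_rhs => rw [pmass, Finset.sum_div]
  refine Finset.sum_congr rfl fun ω _ => ?_
  by_cases h : X ω = s <;> by_cases h' : Z ω = z <;> simp [h, h']

theorem ent_chain {Ω S T : Type*} [Fintype Ω] [Fintype T] {μ : Ω → ℝ} (h0 : ∀ ω, 0 ≤ μ ω)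
    (X : Ω → S) (Z : Ω → T) :
    ∑ z, pmass μ Z z * ent (condMeas μ Z z) X = ent μ (fun ω => (X ω, Z ω)) - ent μ Z := by
  simp_rw [ent_eq, pmass_condMeas]
  have : ∀ z, pmass μ Z z * -∑ ω, condMeas μ Z z ω *
      Real.log (pmass μ (fun ω => (X ω, Z ω)) (X ω, z) / pmass μ Z z)
      = - ∑ ω, if Z ω = z then μ ω * Real.log (pmass μ (fun ω => (X ω, Z ω)) (X ω, Z ω))
         - μ ω * Real.log (pmass μ Z (Z ω)) else 0 := by
    intro z
    rw [mul_neg, Finset.mul_sum]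
    congr 1
    refine Finset.sum_congr rfl fun ω _ => ?_
    unfold condMeas
    split_ifs with h
    · subst h
      rcases (h0 ω).eq_or_lt with h | h
      · simp [← h]
      · have p1 := h.trans_le (le_pmass h0 Z ω)
        have p2 := h.trans_le (le_pmass h0 (fun ω => (X ω, Z ω)) ω)
        rw [Real.log_div p2.ne' p1.ne']
        field_simp
    · simp
  simp_rw [this]
  rw [Finset.sum_neg_distrib, Finset.sum_comm]
  simp only [Finset.sum_ite_eq, Finset.mem_univ, if_true, Finset.sum_sub_distrib]
  ring

theorem isProb_condMeas {Ω T : Type*} [Fintype Ω] {μ : Ω → ℝ} (h0 : ∀ ω, 0 ≤ μ ω)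
    (Z : Ω → T) (z : T) (hz : pmass μ Z z ≠ 0) : IsProb (condMeas μ Z z) := by
  refine ⟨fun ω => ?_, ?_⟩
  · unfold condMeas
    split_ifs
    · exact div_nonneg (h0 _) (pmass_nonneg' h0 _ _)
    · exact le_rfl
  · have : ∀ ω, condMeas μ Z z ω = (if Z ω = z then μ ω else 0) / pmass μ Z z := by
      intro ω; unfold condMeas; split_ifs <;> simp
    simp_rw [this, ← Finset.sum_div]
    exact div_self hz

theorem isProb_prod {Ω₁ Ω₂ : Type*} [Fintype Ω₁] [Fintype Ω₂] {μ₁ : Ω₁ → ℝ} {μ₂ : Ω₂ → ℝ}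
    (h1 : IsProb μ₁) (h2 : IsProb μ₂) : IsProb (fun p : Ω₁ × Ω₂ => μ₁ p.1 * μ₂ p.2) := by
  refine ⟨fun p => mul_nonneg (h1.1 _) (h2.1 _), ?_⟩
  rw [Fintype.sum_prod_type]
  simp_rw [← Finset.mul_sum, h2.2, mul_one, h1.2]

/-- Marginals determine pmass. -/
theorem pmass_of_marginal {Ω Ω' S : Type*} [Fintype Ω] [Fintype Ω'] (ν : Ω' → ℝ) (μ : Ω → ℝ)
    (f : Ω' → Ω) (h : ∀ ω, pmass ν f ω = μ ω) (X : Ω → S) (s : S) :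
    pmass ν (fun p => X (f p)) s = pmass μ X s := by
  have h1 := sum_comp_eq ν f (fun ω => if X ω = s then (1 : ℝ) else 0)
  simp only [h] at h1
  unfold pmass
  simpa using h1

theorem ent_of_marginal {Ω Ω' S : Type*} [Fintype Ω] [Fintype Ω'] (ν : Ω' → ℝ) (μ : Ω → ℝ)
    (f : Ω' → Ω) (h : ∀ ω, pmass ν f ω = μ ω) (X : Ω → S) :
    ent ν (fun p => X (f p)) = ent μ X := by
  rw [ent_eq, ent_eq]
  congr 1
  have := sum_comp_eq ν f (fun ω => Real.log (pmass μ X (X ω)))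
  simp only [h] at this
  rw [← this]
  refine Finset.sum_congr rfl fun p _ => ?_
  rw [pmass_of_marginal ν μ f h]

theorem pmass_snd_prod {Ω₁ Ω₂ : Type*} [Fintype Ω₁] [Fintype Ω₂] {μ₁ : Ω₁ → ℝ} {μ₂ : Ω₂ → ℝ}
    (h1 : IsProb μ₁) (ω : Ω₂) :
    pmass (fun p : Ω₁ × Ω₂ => μ₁ p.1 * μ₂ p.2) Prod.snd ω = μ₂ ω := by
  unfold pmass
  rw [Fintype.sum_prod_type_right, Finset.sum_eq_single ω]
  · simp [← Finset.sum_mul, h1.2]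
  · intro b _ hb; simp [hb]
  · simp

theorem avg_rdist_le {Ω₀ Ω G T : Type*} [Fintype Ω₀] [Fintype Ω] [AddCommGroup G] [Fintype G] [Fintype T]
    {μ₀ : Ω₀ → ℝ} {μ : Ω → ℝ} (h0 : IsProb μ₀) (h : IsProb μ) (X : Ω₀ → G) (Y : Ω → G) (Z : Ω → T) :
    ∑ z, pmass μ Z z * rdist μ₀ X (condMeas μ Z z) Y
      ≤ rdist μ₀ X μ Y + (ent μ Y + ent μ Z - ent μ (fun ω => (Y ω, Z ω))) / 2 := by
  unfold rdist
  set ν := (fun p : Ω₀ × Ω => μ₀ p.1 * μ p.2) with hν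
  have hνp : IsProb ν := isProb_prod h0 h
  have hZ : ∀ z, pmass ν (fun p => Z p.2) z = pmass μ Z z :=
    fun z => pmass_of_marginal ν μ Prod.snd (pmass_snd_prod h0) Z z
  have hc : ∀ z, (fun p : Ω₀ × Ω => μ₀ p.1 * condMeas μ Z z p.2)
      = condMeas ν (fun p => Z p.2) z := by
    intro z; funext p
    unfold condMeas
    rw [hZ]
    split_ifs
    · rw [hν]; ring
    · simp
  simp_rw [hc]
  have e1 := ent_chain hνp.1 (fun p => X p.1 - Y p.2) (fun p => Z p.2)
  have e2 := ent_chain h.1 Y Z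
  have e3 := ent_subadd hνp (fun p => X p.1 - Y p.2) (fun p => Z p.2)
  simp_rw [hZ] at e1
  have e4 := sum_pmass μ Z
  rw [h.2] at e4
  have : ∀ z, pmass μ Z z * (ent (condMeas ν (fun p => Z p.2) z) (fun p => X p.1 - Y p.2)
      - ent μ₀ X / 2 - ent (condMeas μ Z z) Y / 2)
      = pmass μ Z z * ent (condMeas ν (fun p => Z p.2) z) (fun p => X p.1 - Y p.2)
       - pmass μ Z z * (ent μ₀ X / 2) - pmass μ Z z * ent (condMeas μ Z z) Y / 2 := by
    intro z; ring
  simp_rw [this]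
  rw [Finset.sum_sub_distrib, Finset.sum_sub_distrib, e1, ← Finset.sum_mul, ← Finset.sum_div, e2, e4]
  linarith

/-- Two copies of `μ`, conditionally independent relative to `Z`. -/
def condCopy {Ω T : Type*} [Fintype Ω] (μ : Ω → ℝ) (Z : Ω → T) : Ω × Ω → ℝ :=
  fun p => if Z p.1 = Z p.2 then μ p.1 * μ p.2 / pmass μ Z (Z p.1) else 0

theorem condCopy_fst {Ω T : Type*} [Fintype Ω] {μ : Ω → ℝ} (h0 : ∀ ω, 0 ≤ μ ω) (Z : Ω → T) (ω : Ω) :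
    pmass (condCopy μ Z) Prod.fst ω = μ ω := by
  unfold pmass
  rw [Fintype.sum_prod_type, Finset.sum_eq_single ω]
  · simp only [if_true]
    have : ∀ y, condCopy μ Z (ω, y) = (μ ω / pmass μ Z (Z ω)) * if Z y = Z ω then μ y else 0 := by
      intro y; unfold condCopy; simp only [eq_comm (a := Z y)]; split_ifs
      · ring
      · simp
    simp_rw [this, ← Finset.mul_sum]
    change _ * pmass μ Z (Z ω) = _
    rcases (h0 ω).eq_or_lt with h | h
    · simp [← h]
    · exact div_mul_cancel₀ _ (h.trans_le (le_pmass h0 Z ω)).ne'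
  · intro b _ hb; simp [hb]
  · simp

theorem condCopy_swap {Ω T : Type*} [Fintype Ω] (μ : Ω → ℝ) (Z : Ω → T) (x y : Ω) :
    condCopy μ Z (x, y) = condCopy μ Z (y, x) := by
  unfold condCopy
  by_cases h : Z x = Z y
  · simp [h, mul_comm]
  · simp [h, Ne.symm h]

theorem condCopy_snd {Ω T : Type*} [Fintype Ω] {μ : Ω → ℝ} (h0 : ∀ ω, 0 ≤ μ ω) (Z : Ω → T) (ω : Ω) :
    pmass (condCopy μ Z) Prod.snd ω = μ ω := by
  rw [← condCopy_fst h0 Z ω]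
  unfold pmass
  rw [Fintype.sum_prod_type, Fintype.sum_prod_type_right]
  simp_rw [condCopy_swap μ Z]

theorem isProb_condCopy {Ω T : Type*} [Fintype Ω] {μ : Ω → ℝ} (h : IsProb μ) (Z : Ω → T) :
    IsProb (condCopy μ Z) := by
  refine ⟨fun p => ?_, ?_⟩
  · unfold condCopy
    split_ifs
    · exact div_nonneg (mul_nonneg (h.1 _) (h.1 _)) (pmass_nonneg' h.1 _ _)
    · exact le_rfl
  · rw [← sum_pmass (condCopy μ Z) Prod.fst]
    simp_rw [condCopy_fst h.1]
    exact h.2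

/-- Joint entropy of the conditionally independent copies. -/
theorem ent_condCopy {Ω S T : Type*} [Fintype Ω] {μ : Ω → ℝ} (h : IsProb μ)
    (V : Ω → S) (Z : Ω → T) (hVZ : ∀ ω ω', V ω = V ω' → Z ω = Z ω') :
    ent (condCopy μ Z) (fun p => (V p.1, V p.2)) = 2 * ent μ V - ent μ Z := by
  have hp := isProb_condCopy h Z
  have hq : ∀ p : Ω × Ω, Z p.1 = Z p.2 → pmass (condCopy μ Z) (fun p => (V p.1, V p.2)) (V p.1, V p.2)
      = pmass μ V (V p.1) * pmass μ V (V p.2) / pmass μ Z (Z p.1) := by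
    intro p hpz
    conv_lhs => unfold pmass
    rw [Fintype.sum_prod_type]
    conv_rhs => rw [pmass, pmass, Finset.sum_mul_sum, Finset.sum_div]
    refine Finset.sum_congr rfl fun x _ => ?_
    rw [Finset.sum_div]
    refine Finset.sum_congr rfl fun y _ => ?_
    by_cases h1 : V x = V p.1
    · by_cases h2 : V y = V p.2
      · have z1 := hVZ _ _ h1
        have z2 := hVZ _ _ h2
        simp [h1, h2, condCopy, z1, z2, hpz]
      · simp [h2]
    · simp [h1]
  have m1 := ent_of_marginal _ _ Prod.fst (condCopy_fst h.1 Z) V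
  have m2 := ent_of_marginal _ _ Prod.snd (condCopy_snd h.1 Z) V
  have m3 := ent_of_marginal _ _ Prod.fst (condCopy_fst h.1 Z) Z
  rw [two_mul]
  nth_rewrite 1 [← m1]
  rw [← m2, ← m3]
  simp_rw [ent_eq]
  rw [← neg_add, neg_sub_neg, ← sub_eq_zero, ← neg_eq_zero]
  simp only [← Finset.sum_neg_distrib, ← Finset.sum_add_distrib, ← Finset.sum_sub_distrib]
  refine Finset.sum_eq_zero fun p _ => ?_
  rcases (hp.1 p).eq_or_lt with h' | h'
  · simp [← h']
  · have hz : Z p.1 = Z p.2 := by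
      by_contra hne
      simp [condCopy, hne] at h'
    have q1 := h'.trans_le (le_pmass hp.1 (fun p => V p.1) p)
    have q2 := h'.trans_le (le_pmass hp.1 (fun p => V p.2) p)
    have q3 := h'.trans_le (le_pmass hp.1 (fun p => Z p.1) p)
    rw [pmass_of_marginal _ _ Prod.fst (condCopy_fst h.1 Z) V] at q1 ⊢
    rw [pmass_of_marginal _ _ Prod.snd (condCopy_snd h.1 Z) V] at q2 ⊢
    rw [pmass_of_marginal _ _ Prod.fst (condCopy_fst h.1 Z) Z] at q3 ⊢
    rw [hq p hz, Real.log_div (by positivity) q3.ne', Real.log_mul q1.ne' q2.ne']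
    ring

/-- Entropic Balog–Szemerédi–Gowers. -/
theorem ent_bsg {Ω G : Type*} [Fintype Ω] [AddCommGroup G] [Fintype G]
    {μ : Ω → ℝ} (h : IsProb μ) (A B Z : Ω → G) (hZ : ∀ ω, A ω + B ω = Z ω) :
    ∑ z, pmass μ Z z * rdist (condMeas μ Z z) A (condMeas μ Z z) B
      ≤ 2 * (ent μ A + ent μ B + ent μ Z) - 3 * ent μ (fun ω => (A ω, B ω)) := by
  unfold rdist
  set ν := condCopy μ Z with hν
  have hp : IsProb ν := isProb_condCopy h Z
  have hZm : ∀ z, pmass ν (fun p => Z p.1) z = pmass μ Z z :=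
    pmass_of_marginal _ _ Prod.fst (condCopy_fst h.1 Z) Z
  have hc : ∀ z, (fun p : Ω × Ω => condMeas μ Z z p.1 * condMeas μ Z z p.2)
      = condMeas ν (fun p => Z p.1) z := by
    intro z; funext p
    unfold condMeas
    rw [hZm]
    by_cases h1 : Z p.1 = z
    · by_cases h2 : Z p.2 = z
      · simp only [h1, h2, if_true, hν, condCopy]
        ring
      · simp [h1, h2, hν, condCopy, Ne.symm h2]
    · simp [h1]
  simp_rw [hc]
  have e1 := ent_chain hp.1 (fun p => A p.1 - B p.2) (fun p => Z p.1)
  have eA := ent_chain h.1 A Z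
  have eB := ent_chain h.1 B Z
  simp_rw [hZm] at e1
  have e3 := ent_subadd hp (fun p => A p.1 - B p.2) (fun p => Z p.1)
  have e4 := ent_condCopy h (fun ω => (A ω, B ω)) Z (by
    intro ω ω' hh
    rw [Prod.mk.injEq] at hh
    rw [← hZ, ← hZ, hh.1, hh.2])
  have jA : ent μ (fun ω => (A ω, Z ω)) = ent μ (fun ω => (A ω, B ω)) := by
    apply ent_congr
    intro ω ω' _ _
    simp only [Prod.mk.injEq, ← hZ]
    constructor
    · rintro ⟨h1, h2⟩; rw [h1] at h2; exact ⟨h1, add_left_cancel h2⟩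
    · rintro ⟨h1, h2⟩; rw [h1, h2]; exact ⟨rfl, rfl⟩
  have jB : ent μ (fun ω => (B ω, Z ω)) = ent μ (fun ω => (A ω, B ω)) := by
    apply ent_congr
    intro ω ω' _ _
    simp only [Prod.mk.injEq, ← hZ]
    constructor
    · rintro ⟨h1, h2⟩; rw [h1] at h2; exact ⟨add_right_cancel h2, h1⟩
    · rintro ⟨h1, h2⟩; rw [h1, h2]; exact ⟨rfl, rfl⟩
  have supp : ∀ p : Ω × Ω, ν p ≠ 0 → A p.1 + B p.1 = A p.2 + B p.2 := by
    intro p hne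
    rw [hZ, hZ]
    by_contra hne'
    exact hne (by simp [hν, condCopy, hne'])
  have s1 := ent_submod hp (fun p => A p.1) (fun p => B p.1) (fun p => A p.1 - B p.2)
  have t1 : ent ν (fun p => (A p.1, B p.1, A p.1 - B p.2))
      = ent ν (fun p => ((A p.1, B p.1), (A p.2, B p.2))) := by
    apply ent_congr
    intro p p' h1 h2
    have h1 := supp p h1
    have h2 := supp p' h2
    simp only [Prod.mk.injEq]
    constructor
    · rintro ⟨a, b, c⟩
      have d : B p.2 = B p'.2 := by rw [a] at c; exact sub_right_injective c
      refine ⟨⟨a, b⟩, ?_, d⟩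
      rw [a, b, h2, d] at h1
      exact (add_right_cancel h1).symm
    · rintro ⟨⟨a, b⟩, c, d⟩
      rw [a, b, d]; exact ⟨rfl, rfl, rfl⟩
  have t2 : ent ν (fun p => (A p.1, A p.1 - B p.2)) = ent ν (fun p => (A p.1, B p.2)) := by
    apply ent_congr
    intro p p' _ _
    simp only [Prod.mk.injEq]
    constructor
    · rintro ⟨a, c⟩
      rw [a] at c; exact ⟨a, sub_right_injective c⟩
    · rintro ⟨a, d⟩
      rw [a, d]; exact ⟨rfl, rfl⟩
  have t3 : ent ν (fun p => (B p.1, A p.1 - B p.2)) = ent ν (fun p => (A p.2, B p.1)) := by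
    apply ent_congr
    intro p p' h1 h2
    have h1 : A p.1 - B p.2 = A p.2 - B p.1 := by
      rw [sub_eq_sub_iff_add_eq_add]; exact supp p h1
    have h2 : A p'.1 - B p'.2 = A p'.2 - B p'.1 := by
      rw [sub_eq_sub_iff_add_eq_add]; exact supp p' h2
    simp only [Prod.mk.injEq, h1, h2]
    constructor
    · rintro ⟨a, c⟩
      rw [a] at c; exact ⟨sub_left_injective c, a⟩
    · rintro ⟨a, d⟩
      rw [a, d]; exact ⟨rfl, rfl⟩
  have u2 := ent_subadd hp (fun p => A p.1) (fun p => B p.2)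
  have u3 := ent_subadd hp (fun p => A p.2) (fun p => B p.1)
  have m1 := ent_of_marginal ν _ Prod.fst (condCopy_fst h.1 Z) A
  have m2 := ent_of_marginal ν _ Prod.snd (condCopy_snd h.1 Z) A
  have m3 := ent_of_marginal ν _ Prod.fst (condCopy_fst h.1 Z) B
  have m4 := ent_of_marginal ν _ Prod.snd (condCopy_snd h.1 Z) B
  have m5 := ent_of_marginal ν _ Prod.fst (condCopy_fst h.1 Z) Z
  have : ∀ z, pmass μ Z z * (ent (condMeas ν (fun p => Z p.1) z) (fun p => A p.1 - B p.2)
      - ent (condMeas μ Z z) A / 2 - ent (condMeas μ Z z) B / 2)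
      = pmass μ Z z * ent (condMeas ν (fun p => Z p.1) z) (fun p => A p.1 - B p.2)
       - pmass μ Z z * ent (condMeas μ Z z) A / 2 - pmass μ Z z * ent (condMeas μ Z z) B / 2 := by
    intro z; ring
  simp_rw [this]
  rw [Finset.sum_sub_distrib, Finset.sum_sub_distrib, e1, ← Finset.sum_div, ← Finset.sum_div,
    eA, eB]
  linarith

theorem exists_of_avg {T : Type*} [Fintype T] (p F : T → ℝ) (R : ℝ) (h0 : ∀ z, 0 ≤ p z)
    (h1 : ∑ z, p z = 1) (h : ∑ z, p z * F z ≤ R) : ∃ z, p z ≠ 0 ∧ F z ≤ R := by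
  by_contra hcon
  push Not at hcon
  have hle : ∀ z, p z * R ≤ p z * F z := by
    intro z
    by_cases hz : p z = 0
    · simp [hz]
    · exact mul_le_mul_of_nonneg_left (hcon z hz).le (h0 z)
  obtain ⟨z, hz⟩ : ∃ z, p z ≠ 0 := by
    by_contra hn
    push Not at hn
    simp [hn] at h1
  have : ∑ z, p z * R < ∑ z, p z * F z :=
    Finset.sum_lt_sum (fun z _ => hle z) ⟨z, Finset.mem_univ _,
      mul_lt_mul_of_pos_left (hcon z hz) (lt_of_le_of_ne (h0 z) (Ne.symm hz))⟩
  rw [← Finset.sum_mul, h1] at this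
  linarith

theorem good_I {Ω₁ Ω₂ Ω G : Type*} [Fintype Ω₁] [Fintype Ω₂] [Fintype Ω] [AddCommGroup G] [Fintype G]
    {μ₁ : Ω₁ → ℝ} {μ₂ : Ω₂ → ℝ} {μ : Ω → ℝ} (h1 : IsProb μ₁) (h2 : IsProb μ₂) (h : IsProb μ)
    (X₁ : Ω₁ → G) (X₂ : Ω₂ → G) (A B Z : Ω → G) (hZ : ∀ ω, A ω + B ω = Z ω) :
    ∃ μ' : Ω → ℝ, IsProb μ' ∧
      rdist μ' A μ' B + (1/9) * rdist μ₁ X₁ μ' A + (1/9) * rdist μ₂ X₂ μ' B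
      ≤ (2 * (ent μ A + ent μ B + ent μ Z) - 3 * ent μ (fun ω => (A ω, B ω)))
        + (1/9) * (rdist μ₁ X₁ μ A + (ent μ A + ent μ Z - ent μ (fun ω => (A ω, Z ω))) / 2)
        + (1/9) * (rdist μ₂ X₂ μ B + (ent μ B + ent μ Z - ent μ (fun ω => (B ω, Z ω))) / 2) := by
  have a1 := ent_bsg h A B Z hZ
  have a2 := avg_rdist_le h1 h X₁ A Z
  have a3 := avg_rdist_le h2 h X₂ B Z
  obtain ⟨z, hz, hF⟩ := exists_of_avg (pmass μ Z)
    (fun z => rdist (condMeas μ Z z) A (condMeas μ Z z) B + (1/9) * rdist μ₁ X₁ (condMeas μ Z z) A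
      + (1/9) * rdist μ₂ X₂ (condMeas μ Z z) B) _ (pmass_nonneg' h.1 Z)
    (by rw [sum_pmass, h.2]) (le_of_eq rfl)
  refine ⟨condMeas μ Z z, isProb_condMeas h.1 Z z hz, hF.trans ?_⟩
  have : ∀ z, pmass μ Z z * (rdist (condMeas μ Z z) A (condMeas μ Z z) B
      + (1/9) * rdist μ₁ X₁ (condMeas μ Z z) A + (1/9) * rdist μ₂ X₂ (condMeas μ Z z) B)
      = pmass μ Z z * rdist (condMeas μ Z z) A (condMeas μ Z z) B
      + (1/9) * (pmass μ Z z * rdist μ₁ X₁ (condMeas μ Z z) A)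
      + (1/9) * (pmass μ Z z * rdist μ₂ X₂ (condMeas μ Z z) B) := by
    intro z; ring
  simp_rw [this]
  rw [Finset.sum_add_distrib, Finset.sum_add_distrib, ← Finset.mul_sum, ← Finset.mul_sum]
  linarith

/-- **Lemma 6.2.** Let `G = F_2^n`, fix `X₁⁰, X₂⁰, X₁, X₂` and `η = 1/9`. If
`(T₁, T₂, T₃)` is `G³`-valued with `T₁ + T₂ + T₃ = 0` identically and
`δ := I[T₁:T₂] + I[T₁:T₃] + I[T₂:T₃]`, then there exist `G`-valued `T₁', T₂'` with
`d[T₁';T₂'] + η(d[X₁⁰;T₁'] - d[X₁⁰;X₁]) + η(d[X₂⁰;T₂'] - d[X₂⁰;X₂])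
  ≤ δ + (η/3)(δ + Σᵢ Σⱼ (d[Xᵢ⁰;Tⱼ] - d[Xᵢ⁰;Xᵢ]))`. -/
theorem constructing_good_variables {n : ℕ} {Ω₀₁ Ω₀₂ Ω₁ Ω₂ Ω : Type}
    [Fintype Ω₀₁] [Fintype Ω₀₂] [Fintype Ω₁] [Fintype Ω₂] [Fintype Ω]
    (μ₀₁ : Ω₀₁ → ℝ) (μ₀₂ : Ω₀₂ → ℝ) (μ₁ : Ω₁ → ℝ) (μ₂ : Ω₂ → ℝ) (μ : Ω → ℝ)
    (hμ₀₁ : IsProb μ₀₁) (hμ₀₂ : IsProb μ₀₂) (hμ₁ : IsProb μ₁) (hμ₂ : IsProb μ₂)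
    (hμ : IsProb μ)
    (X₀₁ : Ω₀₁ → (Fin n → ZMod 2)) (X₀₂ : Ω₀₂ → (Fin n → ZMod 2))
    (X₁ : Ω₁ → (Fin n → ZMod 2)) (X₂ : Ω₂ → (Fin n → ZMod 2))
    (T₁ T₂ T₃ : Ω → (Fin n → ZMod 2))
    (hsum : ∀ ω, T₁ ω + T₂ ω + T₃ ω = 0)
    (δ : ℝ)
    (hδ : δ = mutualInfo μ T₁ T₂ + mutualInfo μ T₁ T₃ + mutualInfo μ T₂ T₃) :
    ∃ (Ω' : Type) (_ : Fintype Ω') (μ' : Ω' → ℝ)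
      (T₁' T₂' : Ω' → (Fin n → ZMod 2)),
      IsProb μ' ∧
      rdist μ' T₁' μ' T₂'
          + (1/9) * (rdist μ₀₁ X₀₁ μ' T₁' - rdist μ₀₁ X₀₁ μ₁ X₁)
          + (1/9) * (rdist μ₀₂ X₀₂ μ' T₂' - rdist μ₀₂ X₀₂ μ₂ X₂)
        ≤ δ + ((1/9) / 3) *
            (δ + ((rdist μ₀₁ X₀₁ μ T₁ - rdist μ₀₁ X₀₁ μ₁ X₁)
              + (rdist μ₀₁ X₀₁ μ T₂ - rdist μ₀₁ X₀₁ μ₁ X₁)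
              + (rdist μ₀₁ X₀₁ μ T₃ - rdist μ₀₁ X₀₁ μ₁ X₁)
              + (rdist μ₀₂ X₀₂ μ T₁ - rdist μ₀₂ X₀₂ μ₂ X₂)
              + (rdist μ₀₂ X₀₂ μ T₂ - rdist μ₀₂ X₀₂ μ₂ X₂)
              + (rdist μ₀₂ X₀₂ μ T₃ - rdist μ₀₂ X₀₂ μ₂ X₂))) := by
  have two : ∀ x : Fin n → ZMod 2, x + x = 0 := fun x => by
    funext i; exact CharTwo.add_self_eq_zero (x i)
  have neg2 : ∀ x : Fin n → ZMod 2, -x = x := fun x => neg_eq_of_add_eq_zero_left (two x)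
  have s12 : ∀ ω, T₁ ω + T₂ ω = T₃ ω := fun ω => by
    rw [eq_neg_of_add_eq_zero_left (hsum ω), neg2]
  have s13 : ∀ ω, T₁ ω + T₃ ω = T₂ ω := fun ω => by
    rw [← s12, ← add_assoc, two, zero_add]
  have s23 : ∀ ω, T₂ ω + T₃ ω = T₁ ω := fun ω => by
    rw [← s12, add_left_comm, two, add_zero]
  have s21 : ∀ ω, T₂ ω + T₁ ω = T₃ ω := fun ω => by rw [add_comm, s12]
  have s31 : ∀ ω, T₃ ω + T₁ ω = T₂ ω := fun ω => by rw [add_comm, s13]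
  have s32 : ∀ ω, T₃ ω + T₂ ω = T₁ ω := fun ω => by rw [add_comm, s23]
  have sw : ∀ A B : Ω → (Fin n → ZMod 2),
      ent μ (fun ω => (B ω, A ω)) = ent μ (fun ω => (A ω, B ω)) := by
    intro A B
    apply ent_congr
    intro ω ω' _ _
    simp only [Prod.mk.injEq, and_comm]
  have j13 : ent μ (fun ω => (T₁ ω, T₃ ω)) = ent μ (fun ω => (T₁ ω, T₂ ω)) := by
    apply ent_congr
    intro ω ω' _ _
    simp only [Prod.mk.injEq, ← s12]
    constructor
    · rintro ⟨h1, h2⟩; rw [h1] at h2; exact ⟨h1, add_left_cancel h2⟩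
    · rintro ⟨h1, h2⟩; rw [h1, h2]; exact ⟨rfl, rfl⟩
  have j23 : ent μ (fun ω => (T₂ ω, T₃ ω)) = ent μ (fun ω => (T₁ ω, T₂ ω)) := by
    apply ent_congr
    intro ω ω' _ _
    simp only [Prod.mk.injEq, ← s12]
    constructor
    · rintro ⟨h1, h2⟩; rw [h1] at h2; exact ⟨add_right_cancel h2, h1⟩
    · rintro ⟨h1, h2⟩; rw [h1, h2]; exact ⟨rfl, rfl⟩
  have j21 := sw T₁ T₂
  have j31 := sw T₁ T₃
  have j32 := sw T₂ T₃
  rw [j13] at j31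
  rw [j23] at j32
  unfold mutualInfo at hδ
  by_contra hcon
  push Not at hcon
  obtain ⟨m1, p1, q1⟩ := good_I hμ₀₁ hμ₀₂ hμ X₀₁ X₀₂ T₁ T₂ T₃ s12
  obtain ⟨m2, p2, q2⟩ := good_I hμ₀₁ hμ₀₂ hμ X₀₁ X₀₂ T₂ T₁ T₃ s21
  obtain ⟨m3, p3, q3⟩ := good_I hμ₀₁ hμ₀₂ hμ X₀₁ X₀₂ T₁ T₃ T₂ s13
  obtain ⟨m4, p4, q4⟩ := good_I hμ₀₁ hμ₀₂ hμ X₀₁ X₀₂ T₃ T₁ T₂ s31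
  obtain ⟨m5, p5, q5⟩ := good_I hμ₀₁ hμ₀₂ hμ X₀₁ X₀₂ T₂ T₃ T₁ s23
  obtain ⟨m6, p6, q6⟩ := good_I hμ₀₁ hμ₀₂ hμ X₀₁ X₀₂ T₃ T₂ T₁ s32
  have c1 := hcon Ω _ m1 T₁ T₂ p1
  have c2 := hcon Ω _ m2 T₂ T₁ p2
  have c3 := hcon Ω _ m3 T₁ T₃ p3
  have c4 := hcon Ω _ m4 T₃ T₁ p4
  have c5 := hcon Ω _ m5 T₂ T₃ p5
  have c6 := hcon Ω _ m6 T₃ T₂ p6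
  simp only [j13, j23, j21, j31, j32] at q1 q2 q3 q4 q5 q6 hδ
  linarith


end
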